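/- Let π = ∏_{j=1}^{m} t_{k_j}^{i_{k_j}} be a standard OGS elementary element of S_n (2 ≤ k_1 < ⋯ < k_m ≤ n, 0 < i_{k_j} < k_j, ρ₁ := Σ_{j=1}^{m} i_{k_j} ≤ k_1). For 1 ≤ j ≤ m define ϱ_j = Σ_{x=1}^{j} i_{k_x} (with ϱ_0 = 0), θ_j = k_j − ρ₁, κ₋,j = ϱ_{j−1} + θ_j and κ₊,j = ϱ_j + θ_j. Then π^{−1} = t_{κ₊,1}^{θ_1} · ∏_{j=2}^{m} ( t_{κ₋,j}^{ϱ_{j−1}} · t_{κ₊,j}^{θ_j} ) (factors in increasing order of j; the first factor is the identity when k_1 = ρ₁). Moreover, des(π^{−1}) = {κ₋,j : 1 ≤ j ≤ m} when k_1 > ρ₁, and des(π^{−1}) = {κ₋,j : 2 ≤ j ≤ m} when k_1 = ρ₁. -/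

import Mathlib

/-!
Setup for the symmetric group `Sₙ`, realized as `Equiv.Perm (Fin n)` with `Fin n`
encoding `{1, …, n}` (0-indexed positions).  The paper multiplies permutations
left-to-right: `(π·σ)(i) = σ(π(i))`, while Mathlib composes right-to-left:
`(π * σ) i = π (σ i)`.  Hence a paper product `a₁ · a₂ ⋯ a_k` is encoded as the
Mathlib product `a_k * ⋯ * a₂ * a₁` (the leftmost paper factor acts first).
-/

open Equiv Finset

/-- The adjacent transposition `sᵢ` (1-indexed values): the transposition `(i, i+1)`,
as a permutation of `Fin n`; junk value `1` outside the range `1 ≤ i ≤ n-1`. -/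
def sP (n : ℕ) (i : ℕ) : Equiv.Perm (Fin n) :=
  if h : i < n then Equiv.swap ⟨i - 1, by omega⟩ ⟨i, h⟩ else 1

/-- `tₘ = s₁·s₂⋯s_{m−1}` (left-to-right), i.e. the `m`-cycle sending `1 ↦ m` and
`j ↦ j−1` for `2 ≤ j ≤ m` (1-indexed), fixing every `j > m`; `t₁ = 1`. -/
def tP (n : ℕ) (m : ℕ) : Equiv.Perm (Fin n) :=
  if h : m - 1 < n then ((⟨m - 1, h⟩ : Fin n).cycleRange)⁻¹ else 1

/-- The paper's left-to-right product `f a · f (a+1) ⋯ f b` (increasing indices,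
so `f a` acts first), encoded in Mathlib's composition order. -/
def ogsProd {n : ℕ} (a b : ℕ) (f : ℕ → Equiv.Perm (Fin n)) : Equiv.Perm (Fin n) :=
  ((List.range' a (b + 1 - a)).map f).reverse.prod

/-- The paper's left-to-right product `f b · f (b−1) ⋯ f a` (decreasing indices,
so `f b` acts first), encoded in Mathlib's composition order. -/
def ogsProdDesc {n : ℕ} (a b : ℕ) (f : ℕ → Equiv.Perm (Fin n)) : Equiv.Perm (Fin n) :=
  ((List.range' a (b + 1 - a)).map f).prod

/-- The Coxeter length of `π`: the number of inversions, i.e. of pairs `i < j`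
with `π(i) > π(j)`. -/
def len {n : ℕ} (π : Equiv.Perm (Fin n)) : ℕ :=
  (Finset.univ.filter fun p : Fin n × Fin n => p.1 < p.2 ∧ π p.2 < π p.1).card

/-- The descent set of `π`: the set of 1-indexed positions `i ∈ {1, …, n−1}`
with `π(i) > π(i+1)`. -/
def descents {n : ℕ} (π : Equiv.Perm (Fin n)) : Finset ℕ :=
  (Finset.Ico 1 n).filter fun i => ∃ h : i < n, π ⟨i, h⟩ < π ⟨i - 1, by omega⟩

theorem ogsProd_eq_one {n a b : ℕ} (f : ℕ → Equiv.Perm (Fin n)) (h : b < a) :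
    ogsProd a b f = 1 := by
  simp [ogsProd, Nat.sub_eq_zero_of_le (Nat.succ_le_of_lt h)]

theorem ogsProd_succ {n a b : ℕ} (f : ℕ → Equiv.Perm (Fin n)) (h : a ≤ b + 1) :
    ogsProd a (b + 1) f = f (b + 1) * ogsProd a b f := by
  have h1 : b + 1 + 1 - a = (b + 1 - a) + 1 := by omega
  have h2 : a + (b + 1 - a) = b + 1 := by omega
  simp [ogsProd, h1, List.range'_concat, h2]

theorem tP_apply_val {n k : ℕ} (hk : k ≤ n) (x : Fin n) :
    (tP n k x : ℕ) = if (x : ℕ) < k then (if (x : ℕ) = 0 then k - 1 else x - 1) else x := by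
  have hn := x.isLt
  have hkn : k - 1 < n := by omega
  obtain ⟨n, rfl⟩ : ∃ N, n = N + 1 := ⟨n - 1, by omega⟩
  obtain ⟨y, rfl⟩ := (Fin.cycleRange (⟨k - 1, hkn⟩ : Fin (n + 1))).surjective x
  rw [tP, dif_pos hkn, Equiv.Perm.inv_def, Equiv.symm_apply_apply]
  rcases lt_trichotomy y ⟨k - 1, hkn⟩ with h | h | h
  · have hy : (y : ℕ) < k - 1 := h
    have := Fin.coe_cycleRange_of_lt h
    split_ifs <;> omega
  · have hy : (y : ℕ) = k - 1 := congrArg Fin.val h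
    rw [Fin.cycleRange_of_eq h, Fin.val_zero]
    split_ifs <;> omega
  · have hy : k - 1 < (y : ℕ) := h
    rw [Fin.cycleRange_of_gt h]
    split_ifs <;> omega

theorem tP_pow_apply_val {n k a : ℕ} (hk : k ≤ n) (ha : a ≤ k) (x : Fin n) :
    ((tP n k ^ a) x : ℕ) =
      if (x : ℕ) < a then x + (k - a) else if (x : ℕ) < k then x - a else x := by
  induction a with
  | zero => simp
  | succ a ih =>
    rw [pow_succ', Equiv.Perm.mul_apply, tP_apply_val hk, ih (by omega)]
    split_ifs <;> omega

/-- Values of the partial products of an elementary element, in terms of the partial sums `r`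
of its exponents. -/
theorem elementary_partial_apply {n m : ℕ} {k i r : ℕ → ℕ}
    (hkn : ∀ j, 1 ≤ j → j ≤ m → k j ≤ n) (hk : MonotoneOn k (Set.Icc 1 m))
    (hr0 : r 0 = 0) (hr : ∀ j, r (j + 1) = r j + i (j + 1)) (hsum : r m ≤ k 1)
    {j : ℕ} (hj : j ≤ m) (x : Fin n) :
    (∀ l, 1 ≤ l → l ≤ j → r (l - 1) ≤ x → x < r l →
      (ogsProd 1 j (fun j => tP n (k j) ^ i j) x : ℕ) = x + k l - r j) ∧
    (∀ l, l < j → (1 ≤ l → k l ≤ x) → x < k (l + 1) → r j ≤ x →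
      (ogsProd 1 j (fun j => tP n (k j) ^ i j) x : ℕ) = x + r l - r j) ∧
    ((1 ≤ j → k j ≤ x) → (ogsProd 1 j (fun j => tP n (k j) ^ i j) x : ℕ) = x) := by
  have hrm : Monotone r := monotone_nat_of_le_succ fun j => by have := hr j; omega
  induction j with
  | zero =>
    rw [ogsProd_eq_one _ (by omega)]
    exact ⟨fun l _ _ => by omega, fun l hl => by omega, fun _ => rfl⟩
  | succ j ih =>
    obtain ⟨hA, hB, hC⟩ := ih (by omega)
    have hrj := hr j
    have hrjm : r (j + 1) ≤ r m := hrm hj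
    have hkk : ∀ l, 1 ≤ l → l ≤ j + 1 → k 1 ≤ k l ∧ k l ≤ k (j + 1) := fun l h1 h2 =>
      ⟨hk ⟨le_rfl, by omega⟩ ⟨h1, by omega⟩ h1, hk ⟨h1, by omega⟩ ⟨by omega, hj⟩ h2⟩
    have hk1 := hkk (j + 1) (by omega) le_rfl
    rw [ogsProd_succ _ (by omega), Equiv.Perm.mul_apply,
      tP_pow_apply_val (hkn _ (by omega) hj) (by omega)]
    refine ⟨fun l hl1 hlj hxl hxr => ?_, fun l hlj hkl hxk hrx => ?_, fun hx => ?_⟩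
    · have hkl := hkk l hl1 hlj
      rcases hlj.lt_or_eq with h | rfl
      · rw [hA l hl1 (by omega) hxl hxr]
        have := hrm (show l ≤ j by omega)
        split_ifs <;> omega
      · rw [Nat.add_sub_cancel] at hxl
        rcases Nat.eq_zero_or_pos j with rfl | hj0
        · rw [hC (by omega)]
          split_ifs <;> omega
        · rw [hB 0 hj0 (by omega) (by simp only [Nat.zero_add]; omega) hxl]
          split_ifs <;> omega
    · have hkl1 := hkk (l + 1) (by omega) (by omega)
      rcases (show l ≤ j by omega).lt_or_eq with h | rfl
      · have := hrm h.le
        rw [hB l h hkl hxk (by omega)]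
        split_ifs <;> omega
      · rw [hC hkl]
        split_ifs <;> omega
    · have hx' := hx (by omega)
      rw [hC fun h => (hkk j h (by omega)).2.trans hx']
      split_ifs <;> omega

/-- Values of the partial products in the formula for the inverse of an elementary element. -/
theorem elementary_inverse_partial_apply {n m : ℕ} {r θ κm κp : ℕ → ℕ}
    (hκpn : ∀ j, 1 ≤ j → j ≤ m → κp j ≤ n) (hθ : MonotoneOn θ (Set.Icc 1 m))
    (hr0 : r 0 = 0) (hrm : Monotone r)
    (hκm : ∀ j, κm j = r (j - 1) + θ j) (hκp : ∀ j, κp j = r j + θ j)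
    {j : ℕ} (hj1 : 1 ≤ j) (hj : j ≤ m) (y : Fin n) :
    let q : Equiv.Perm (Fin n) :=
      ogsProd 2 j (fun j => tP n (κp j) ^ θ j * tP n (κm j) ^ r (j - 1)) * tP n (κp 1) ^ θ 1
    (∀ l, 1 ≤ l → l ≤ j → κm l ≤ y → y < κp l → (q y : ℕ) = y - θ l) ∧
    (∀ l, l < j → (1 ≤ l → κp l ≤ y) → y < κm (l + 1) → (q y : ℕ) = y + r j - r l) ∧
    (κp j ≤ y → (q y : ℕ) = y) := by
  induction j, hj1 using Nat.le_induction with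
  | base =>
    have h1 := hκm 1
    have h2 := hκp 1
    rw [Nat.sub_self] at h1
    rw [ogsProd_eq_one _ (by omega), one_mul]
    simp only [tP_pow_apply_val (hκpn 1 le_rfl hj) (show θ 1 ≤ κp 1 by omega)]
    refine ⟨fun l hl1 hl hy hy' => ?_, fun l hl hy hy' => ?_, fun hy => ?_⟩
    · obtain rfl : l = 1 := by omega
      split_ifs <;> omega
    · obtain rfl : l = 0 := by omega
      rw [Nat.zero_add] at hy'
      split_ifs <;> omega
    · split_ifs <;> omega
  | succ j hj1 ih =>
    obtain ⟨hA, hB, hC⟩ := ih (by omega)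
    have hm := hκm (j + 1)
    have hp := hκp (j + 1)
    have hpj := hκp j
    rw [Nat.add_sub_cancel] at hm
    have hrj : r j ≤ r (j + 1) := hrm (by omega)
    have hpn := hκpn (j + 1) (by omega) hj
    have hθj : ∀ l, 1 ≤ l → l ≤ j + 1 → θ l ≤ θ (j + 1) := fun l h1 h2 =>
      hθ ⟨h1, by omega⟩ ⟨by omega, hj⟩ h2
    have hθjj := hθj j hj1 (by omega)
    rw [ogsProd_succ _ (by omega), mul_assoc, mul_assoc]
    simp only [Equiv.Perm.mul_apply _ (_ * _)]
    simp only [Nat.add_sub_cancel, tP_pow_apply_val hpn (show θ (j + 1) ≤ κp (j + 1) by omega),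
      tP_pow_apply_val (show κm (j + 1) ≤ n by omega) (show r j ≤ κm (j + 1) by omega)]
    refine ⟨fun l hl1 hl hy hy' => ?_, fun l hl hy hy' => ?_, fun hy => ?_⟩
    · have hml := hκm l
      have hpl := hκp l
      rcases hl.lt_or_eq with h | rfl
      · rw [hA l hl1 (by omega) hy hy']
        have := hrm (show l ≤ j by omega)
        split_ifs <;> omega
      · rw [hC (by omega)]
        split_ifs <;> omega
    · have hml := hκm (l + 1)
      rw [Nat.add_sub_cancel] at hml
      have hrl := hrm (show l ≤ j by omega)
      have hpl := hκp l
      have hθl := hθj (l + 1) (by omega) (by omega)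
      have hle : r l ≤ y := by
        rcases Nat.eq_zero_or_pos l with rfl | h
        · omega
        · have := hy h
          omega
      rcases (show l ≤ j by omega).lt_or_eq with h | rfl
      · rw [hB l h hy hy']
        split_ifs <;> omega
      · rw [hC (hy hj1)]
        split_ifs <;> omega
    · rw [hC (by omega)]
      split_ifs <;> omega

/-- The intervals `[κm l, κp l)` and `[κp l, κm (l + 1))` cover `[0, κp j)`. -/
theorem exists_block {κm κp : ℕ → ℕ} {j : ℕ} (hj : 1 ≤ j) (y : ℕ) :
    (∃ l, 1 ≤ l ∧ l ≤ j ∧ κm l ≤ y ∧ y < κp l) ∨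
    (∃ l, l < j ∧ (1 ≤ l → κp l ≤ y) ∧ y < κm (l + 1)) ∨ κp j ≤ y := by
  induction j, hj using Nat.le_induction with
  | base =>
    by_cases h1 : y < κm 1
    · exact .inr (.inl ⟨0, by omega, by omega, h1⟩)
    · by_cases h2 : y < κp 1
      · exact .inl ⟨1, le_rfl, le_rfl, by omega, h2⟩
      · exact .inr (.inr (by omega))
  | succ j hj ih =>
    rcases ih with ⟨l, h1, h2, h3⟩ | ⟨l, h1, h2⟩ | h
    · exact .inl ⟨l, h1, by omega, h3⟩
    · exact .inr (.inl ⟨l, by omega, h2⟩)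
    · by_cases h1 : y < κm (j + 1)
      · exact .inr (.inl ⟨j, by omega, fun _ => h, h1⟩)
      · by_cases h2 : y < κp (j + 1)
        · exact .inl ⟨j + 1, by omega, le_rfl, by omega, h2⟩
        · exact .inr (.inr (by omega))

/-- The descents of a permutation given blockwise as in `elementary_inverse_partial_apply`. -/
theorem mem_descents_iff_of_blocks {n m : ℕ} {r θ κm κp : ℕ → ℕ} (hm : 1 ≤ m)
    (hκpn : ∀ j, 1 ≤ j → j ≤ m → κp j ≤ n) (hθ : StrictMonoOn θ (Set.Icc 1 m))
    (hr0 : r 0 = 0) (hr : ∀ j, 1 ≤ j → j ≤ m → r (j - 1) < r j) (hrm : Monotone r)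
    (hκm : ∀ j, κm j = r (j - 1) + θ j) (hκp : ∀ j, κp j = r j + θ j)
    {q : Equiv.Perm (Fin n)}
    (hq : ∀ y : Fin n, (∀ l, 1 ≤ l → l ≤ m → κm l ≤ y → y < κp l → (q y : ℕ) = y - θ l) ∧
      (∀ l, l < m → (1 ≤ l → κp l ≤ y) → y < κm (l + 1) → (q y : ℕ) = y + r m - r l) ∧
      (κp m ≤ y → (q y : ℕ) = y)) (c : ℕ) :
    c ∈ descents q ↔ 1 ≤ c ∧ ∃ j, 1 ≤ j ∧ j ≤ m ∧ κm j = c := by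
  simp only [descents, mem_filter, mem_Ico, Fin.lt_def]
  constructor
  · rintro ⟨⟨hc1, hcn⟩, hc, hlt⟩
    refine ⟨hc1, ?_⟩
    by_contra! hne
    obtain ⟨hA, hB, hC⟩ := hq ⟨c, hc⟩
    obtain ⟨hA', hB', hC'⟩ := hq ⟨c - 1, by omega⟩
    dsimp only at hA hB hC hA' hB' hC'
    rcases exists_block (κm := κm) (κp := κp) hm c with
      ⟨l, hl1, hlm, hy, hy'⟩ | ⟨l, hlm, hy, hy'⟩ | hy
    · have := hne l hl1 hlm
      rw [hA l hl1 hlm hy hy', hA' l hl1 hlm (by omega) (by omega)] at hlt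
      omega
    · rw [hB l hlm hy hy'] at hlt
      have hrl := hrm hlm.le
      by_cases h : 1 ≤ l → κp l ≤ c - 1
      · rw [hB' l hlm h (by omega)] at hlt
        omega
      · push Not at h
        have h1 := hκm l
        have h2 := hκp l
        have h3 := hr l h.1 hlm.le
        have h4 := hy h.1
        rw [hA' l h.1 hlm.le (by omega) h.2] at hlt
        omega
    · rw [hC hy] at hlt
      have h1 := hκm m
      have h2 := hκp m
      have h3 := hr m hm le_rfl
      by_cases h : κp m ≤ c - 1
      · rw [hC' h] at hlt
        omega
      · rw [hA' m hm le_rfl (by omega) (by omega)] at hlt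
        omega
  · rintro ⟨hc1, j, hj1, hjm, rfl⟩
    have h1 := hκm j
    have h2 := hκp j
    have h3 := hr j hj1 hjm
    have h4 := hκpn j hj1 hjm
    have h5 := hrm hjm
    have hprev : 1 ≤ j - 1 → κp (j - 1) ≤ κm j - 1 := fun h => by
      have := hθ ⟨h, by omega⟩ ⟨hj1, hjm⟩ (show j - 1 < j by omega)
      have := hκp (j - 1)
      omega
    have hpos : 1 ≤ θ j := by
      rcases hj1.lt_or_eq with h | rfl
      · have := hθ ⟨le_rfl, hm⟩ ⟨hj1, hjm⟩ h
        omega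
      · rw [Nat.sub_self, hr0] at h1
        omega
    refine ⟨⟨hc1, by omega⟩, by omega, ?_⟩
    rw [(hq _).1 j hj1 hjm le_rfl (by dsimp only; omega),
      (hq _).2.1 (j - 1) (by omega) hprev (by rw [Nat.sub_add_cancel hj1]; dsimp only; omega)]
    dsimp only
    omega

/-- Inverse of a standard OGS elementary element
`π = ∏_{j=1}^{m} t_{k_j}^{i_j}` (`ρ₁ = Σ i_j ≤ k₁`): with `ϱ_j = Σ_{x≤j} i_x`,
`θ_j = k_j − ρ₁`, `κ₋ⱼ = ϱ_{j−1} + θ_j`, `κ₊ⱼ = ϱ_j + θ_j`, one has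
`π⁻¹ = t_{κ₊₁}^{θ₁} · ∏_{j=2}^{m} (t_{κ₋ⱼ}^{ϱ_{j−1}} · t_{κ₊ⱼ}^{θ_j})`
(paper product, left-to-right; the first factor is the identity when `k₁ = ρ₁`),
and `des(π⁻¹) = {κ₋ⱼ : 1 ≤ j ≤ m}` if `k₁ > ρ₁`, while
`des(π⁻¹) = {κ₋ⱼ : 2 ≤ j ≤ m}` if `k₁ = ρ₁`. -/
theorem elementary_inverse (n m : ℕ) (k i : ℕ → ℕ) (hm : 1 ≤ m)
    (hk : ∀ j, 1 ≤ j → j ≤ m → 2 ≤ k j ∧ k j ≤ n)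
    (hmono : ∀ j, 1 ≤ j → j < m → k j < k (j + 1))
    (hi : ∀ j, 1 ≤ j → j ≤ m → 0 < i j ∧ i j < k j)
    (hsum : ∑ j ∈ Finset.Icc 1 m, i j ≤ k 1)
    (ϱ θ κm κp : ℕ → ℕ)
    (hϱ : ∀ j, ϱ j = ∑ x ∈ Finset.Icc 1 j, i x)
    (hθ : ∀ j, θ j = k j - ∑ x ∈ Finset.Icc 1 m, i x)
    (hκm : ∀ j, κm j = ϱ (j - 1) + θ j)
    (hκp : ∀ j, κp j = ϱ j + θ j)
    (π : Equiv.Perm (Fin n)) (hπ : π = ogsProd 1 m fun j => tP n (k j) ^ i j) :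
    π⁻¹ = ogsProd 2 m (fun j => tP n (κp j) ^ θ j * tP n (κm j) ^ ϱ (j - 1)) *
        tP n (κp 1) ^ θ 1 ∧
    ((∑ j ∈ Finset.Icc 1 m, i j < k 1 →
        descents π⁻¹ = (Finset.Icc 1 m).image κm) ∧
     (k 1 = ∑ j ∈ Finset.Icc 1 m, i j →
        descents π⁻¹ = (Finset.Icc 2 m).image κm)) := by
  have hr0 : ϱ 0 = 0 := by simp [hϱ]
  have hr : ∀ j, ϱ (j + 1) = ϱ j + i (j + 1) := fun j => by
    rw [hϱ, hϱ, Finset.sum_Icc_succ_top (by omega)]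
  have hrm : Monotone ϱ := monotone_nat_of_le_succ fun j => by have := hr j; omega
  rw [← hϱ] at hsum ⊢
  simp only [← hϱ] at hθ
  have hkS : StrictMonoOn k (Set.Icc 1 m) :=
    strictMonoOn_of_lt_add_one Set.ordConnected_Icc fun a _ ha ha' => hmono a ha.1 ha'.2
  have hkθ : ∀ j, 1 ≤ j → j ≤ m → k j = θ j + ϱ m := fun j h1 h2 => by
    have := hkS.monotoneOn ⟨le_rfl, hm⟩ ⟨h1, h2⟩ h1
    have := hθ j
    omega
  have hθS : StrictMonoOn θ (Set.Icc 1 m) := fun a ha b hb hab => by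
    have := hkS ha hb hab
    have := hkθ a ha.1 ha.2
    have := hkθ b hb.1 hb.2
    omega
  have hκpn : ∀ j, 1 ≤ j → j ≤ m → κp j ≤ n := fun j h1 h2 => by
    have := (hk j h1 h2).2
    have := hkθ j h1 h2
    have := hκp j
    have := hrm h2
    omega
  have hlt : ∀ j, 1 ≤ j → j ≤ m → ϱ (j - 1) < ϱ j := fun j h1 h2 => by
    have h := hr (j - 1)
    rw [Nat.sub_add_cancel h1] at h
    have := (hi j h1 h2).1
    omega
  have hq := elementary_inverse_partial_apply hκpn hθS.monotoneOn hr0 hrm hκm hκp hm le_rfl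
  dsimp only at hq
  have hp := elementary_partial_apply (fun j h1 h2 => (hk j h1 h2).2) hkS.monotoneOn hr0 hr hsum
    (le_refl m)
  rw [← hπ] at hp
  have hinv : π⁻¹ = ogsProd 2 m (fun j => tP n (κp j) ^ θ j * tP n (κm j) ^ ϱ (j - 1)) *
      tP n (κp 1) ^ θ 1 := by
    set q := ogsProd 2 m (fun j => tP n (κp j) ^ θ j * tP n (κm j) ^ ϱ (j - 1)) *
      tP n (κp 1) ^ θ 1
    refine inv_eq_of_mul_eq_one_right (Equiv.ext fun y => Fin.ext ?_)
    rw [Equiv.Perm.mul_apply, Equiv.Perm.one_apply]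
    obtain ⟨hA, hB, hC⟩ := hq y
    obtain ⟨hA', hB', hC'⟩ := hp (q y)
    rcases exists_block (κm := κm) (κp := κp) hm (y : ℕ) with
      ⟨l, hl1, hlm, hy, hy'⟩ | ⟨l, hlm, hy, hy'⟩ | hy
    · have := hA l hl1 hlm hy hy'
      have := hκm l
      have := hκp l
      have := hkθ l hl1 hlm
      rw [hA' l hl1 hlm (by omega) (by omega)]
      omega
    · have := hB l hlm hy hy'
      have hml := hκm (l + 1)
      rw [Nat.add_sub_cancel] at hml
      have := hkθ (l + 1) (by omega) hlm
      have := hrm hlm.le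
      have hkl : 1 ≤ l → k l ≤ q y ∧ ϱ l ≤ y := fun h => by
        have := hy h
        have := hκp l
        have := hkθ l h hlm.le
        omega
      have hle : ϱ l ≤ y := by
        rcases Nat.eq_zero_or_pos l with rfl | h
        · omega
        · exact (hkl h).2
      rw [hB' l hlm (fun h => (hkl h).1) (by omega) (by omega)]
      omega
    · have := hC hy
      have := hκp m
      have := hkθ m hm le_rfl
      rw [hC' fun _ => by omega]
      omega
  have hdes := mem_descents_iff_of_blocks hm hκpn hθS hr0 hlt hrm hκm hκp hq
  rw [← hinv] at hdes
  have h1 := hκm 1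
  rw [Nat.sub_self, hr0, Nat.zero_add] at h1
  have hk1 := hkθ 1 le_rfl hm
  have hpos : ∀ j, 2 ≤ j → j ≤ m → 1 ≤ κm j := fun j h2 hjm => by
    have := hθS ⟨le_rfl, hm⟩ ⟨by omega, hjm⟩ (show 1 < j by omega)
    have := hκm j
    omega
  refine ⟨hinv, fun hlt1 => ?_, fun heq => ?_⟩
  · ext c
    simp only [hdes, mem_image, mem_Icc, and_assoc]
    refine ⟨fun h => h.2, fun h => ⟨?_, h⟩⟩
    obtain ⟨j, hj1, hjm, rfl⟩ := h
    rcases hj1.lt_or_eq with h | rfl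
    · exact hpos j h hjm
    · omega
  · ext c
    simp only [hdes, mem_image, mem_Icc, and_assoc]
    constructor
    · rintro ⟨hc, j, hj1, hjm, rfl⟩
      refine ⟨j, ?_, hjm, rfl⟩
      rcases hj1.lt_or_eq with h | rfl
      · exact h
      · omega
    · rintro ⟨j, hj2, hjm, rfl⟩
      exact ⟨hpos j hj2 hjm, j, by omega, hjm, rfl⟩
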